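/- arXiv:1803.06847 — 2 statements merged into one kernel-verified Lean document; each statement's English description precedes it below -/
import Mathlib

section
/- Let n ≥ 2, 1 ≤ p ≤ 2, and let X be a random vector uniformly distributed on the ℓ_p unit ball B_p^n. Set ξ1 = (e1+e2)/√2 and ξ2 = (e1−e2)/√2, and define f(η1,η2) = E[⟨X,η1⟩²⟨X,η2⟩²] − E[⟨X,η1⟩²]·E[⟨X,η2⟩²]. Then for every pair of orthonormal vectors η1, η2 in the unit sphere S^{n−1} one has f(e1,e2) ≤ f(η1,η2) ≤ f(ξ1,ξ2). -/
open MeasureTheory Real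
open scoped RealInnerProductSpace ENNReal

noncomputable section

/-- `ℝⁿ` with the Euclidean structure. -/
abbrev E (n : ℕ) := EuclideanSpace ℝ (Fin n)

/-- The unit ball of the `ℓ_p` norm on `ℝⁿ`. -/
def lpBall (n : ℕ) (p : ℝ) : Set (E n) := {x | ∑ i, |x i| ^ p ≤ 1}

/-- The uniform probability measure (normalized Lebesgue measure) on a set `K ⊆ ℝⁿ`. -/
def unif {n : ℕ} (K : Set (E n)) : Measure (E n) := (volume K)⁻¹ • volume.restrict K

/-- `f(η₁,η₂) = E⟨X,η₁⟩²⟨X,η₂⟩² - E⟨X,η₁⟩² E⟨X,η₂⟩²` for `X` distributed according to `μ`. -/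
def covf {n : ℕ} (μ : Measure (E n)) (a b : E n) : ℝ :=
  (∫ x, ⟪x, a⟫ ^ 2 * ⟪x, b⟫ ^ 2 ∂μ) - (∫ x, ⟪x, a⟫ ^ 2 ∂μ) * (∫ x, ⟪x, b⟫ ^ 2 ∂μ)

/-- The canonical basis vectors of `ℝⁿ`. -/
def stdb {n : ℕ} (i : Fin n) : E n := EuclideanSpace.single i 1


theorem aux_concave {a b c d q : ℝ} (ha : 0 ≤ a) (hb : 0 ≤ b)
    (hq0 : 0 ≤ q) (hq1 : q ≤ 1) (hs : a + b = c + d) (h : |c - d| ≤ |a - b|) :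
    a ^ q + b ^ q ≤ c ^ q + d ^ q := by
  by_cases hab : a = b
  · subst hab
    simp at h
    have : c = d := by linarith
    subst this
    have : a = c := by linarith
    subst this
    rfl
  have hne : b - a ≠ 0 := fun h => hab (by linarith)
  set t := (c - a) / (b - a) with ht
  have hc : c = (1 - t) * a + t * b := by
    rw [ht]; field_simp; ring
  have hd : d = t * a + (1 - t) * b := by linarith
  have hcd : c - d = (2 * t - 1) * (b - a) := by rw [hc, hd]; ring
  have ht2 : |2 * t - 1| ≤ 1 := by
    rw [hcd, abs_mul, abs_sub_comm a b] at h
    have : 0 < |b - a| := abs_pos.mpr hne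
    nlinarith
  have ⟨h1, h2⟩ := abs_le.mp ht2
  have ht0 : 0 ≤ t := by linarith
  have ht1 : 0 ≤ 1 - t := by linarith
  have key := Real.concaveOn_rpow hq0 hq1
  have k1 := key.2 (x := a) (y := b) ha hb ht1 ht0 (by ring)
  have k2 := key.2 (x := a) (y := b) ha hb ht0 ht1 (by ring)
  simp only [smul_eq_mul] at k1 k2
  rw [← hc] at k1
  rw [← hd] at k2
  linarith

theorem abs_rpow_eq (x p : ℝ) : |x| ^ p = (x ^ 2) ^ (p / 2) := by
  rw [← sq_abs, ← Real.rpow_natCast, ← Real.rpow_mul (abs_nonneg x)]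
  congr 1
  push_cast; ring

theorem aux_pair {p x y u v : ℝ} (hp0 : 0 ≤ p) (hp2 : p ≤ 2) (hu : u = (Real.sqrt 2)⁻¹ * (x + y))
    (hv : v = (Real.sqrt 2)⁻¹ * (x - y)) (h : 0 ≤ x ^ 4 + y ^ 4 - 6 * x ^ 2 * y ^ 2) :
    |x| ^ p + |y| ^ p ≤ |u| ^ p + |v| ^ p := by
  have h2 : ((Real.sqrt 2)⁻¹) ^ 2 = 1 / 2 := by
    rw [inv_pow, Real.sq_sqrt (by norm_num)]; norm_num
  have hu2 : u ^ 2 = (x + y) ^ 2 / 2 := by rw [hu, mul_pow, h2]; ring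
  have hv2 : v ^ 2 = (x - y) ^ 2 / 2 := by rw [hv, mul_pow, h2]; ring
  simp only [abs_rpow_eq]
  apply aux_concave (sq_nonneg _) (sq_nonneg _) (by linarith) (by linarith)
  · rw [hu2, hv2]; ring
  · rw [hu2, hv2]
    apply sq_le_sq.mp
    nlinarith

theorem integral_unif_comp {n : ℕ} {K : Set (E n)} (T : E n ≃ₗᵢ[ℝ] E n)
    (hT : ∀ x, T x ∈ K ↔ x ∈ K) (g : E n → ℝ) :
    ∫ x, g (T x) ∂(unif K) = ∫ x, g x ∂(unif K) := by
  have hpre : T ⁻¹' K = K := Set.ext hT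
  unfold unif
  rw [integral_smul_measure, integral_smul_measure]
  congr 1
  have := T.measurePreserving.setIntegral_preimage_emb T.toHomeomorph.measurableEmbedding g K
  rw [hpre] at this
  exact this

theorem lpBall_closed (n : ℕ) (p : ℝ) (hp : 1 ≤ p) : IsClosed (lpBall n p) := by
  unfold lpBall
  apply isClosed_le _ continuous_const
  apply continuous_finsetSum
  intro i _
  apply Continuous.rpow_const (by fun_prop)
  intro x; right; linarith

theorem lpBall_coord {n : ℕ} {p : ℝ} (hp : 1 ≤ p) {x : E n} (hx : x ∈ lpBall n p) (i : Fin n) :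
    |x i| ≤ 1 := by
  have h1 : |x i| ^ p ≤ 1 := by
    refine le_trans ?_ hx
    exact Finset.single_le_sum (f := fun i => |x i| ^ p)
      (fun j _ => Real.rpow_nonneg (abs_nonneg _) _) (Finset.mem_univ i)
  by_contra h
  push Not at h
  have := Real.one_lt_rpow h (by linarith : 0 < p)
  linarith

instance unif_finite {n : ℕ} (K : Set (E n)) : IsFiniteMeasure (unif K) := by
  constructor
  unfold unif
  simp only [Measure.smul_apply, Measure.restrict_apply MeasurableSet.univ, Set.univ_inter,
    smul_eq_mul]
  exact lt_of_le_of_lt (ENNReal.inv_mul_le_one _) (by simp)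

theorem ae_unif {n : ℕ} {p : ℝ} (hp : 1 ≤ p) :
    ∀ᵐ x ∂(unif (lpBall n p)), x ∈ lpBall n p := by
  unfold unif
  apply Measure.ae_smul_measure
  exact ae_restrict_mem (lpBall_closed n p hp).measurableSet

theorem integrable_prod4 {n : ℕ} {p : ℝ} (hp : 1 ≤ p) (i j k l : Fin n) :
    Integrable (fun x : E n => x i * x j * x k * x l) (unif (lpBall n p)) := by
  apply Integrable.of_bound (C := 1) (Continuous.aestronglyMeasurable (by fun_prop))
  filter_upwards [ae_unif hp] with x hx
  have := lpBall_coord hp hx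
  simp only [norm_mul, Real.norm_eq_abs]
  have h1 := mul_le_one₀ (this i) (abs_nonneg _) (this j)
  have h2 := mul_le_one₀ h1 (abs_nonneg _) (this k)
  exact mul_le_one₀ h2 (abs_nonneg _) (this l)

theorem integrable_prod2 {n : ℕ} {p : ℝ} (hp : 1 ≤ p) (i j : Fin n) :
    Integrable (fun x : E n => x i * x j) (unif (lpBall n p)) := by
  apply Integrable.of_bound (C := 1) (Continuous.aestronglyMeasurable (by fun_prop))
  filter_upwards [ae_unif hp] with x hx
  have := lpBall_coord hp hx
  simp only [norm_mul, Real.norm_eq_abs]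
  exact mul_le_one₀ (this i) (abs_nonneg _) (this j)

/-- permutation of coordinates -/
theorem integral_perm {n : ℕ} {p : ℝ} (σ : Equiv.Perm (Fin n)) (g : (Fin n → ℝ) → ℝ) :
    ∫ x : E n, g (fun i => x (σ i)) ∂(unif (lpBall n p)) =
      ∫ x : E n, g (fun i => x i) ∂(unif (lpBall n p)) := by
  have := integral_unif_comp (K := lpBall n p) (LinearIsometryEquiv.piLpCongrLeft 2 ℝ ℝ σ.symm)
    (by
      intro x
      simp only [lpBall, Set.mem_ofPred_eq, LinearIsometryEquiv.piLpCongrLeft_apply]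
      have : ∑ i, |x (σ i)| ^ p = ∑ i, |x i| ^ p := Equiv.sum_comp σ (fun i => |x i| ^ p)
      rw [← this]
      rfl) (fun x => g (fun i => x i))
  rw [← this]
  rfl

/-- sign change of one coordinate -/
theorem integral_sign {n : ℕ} {p : ℝ} (s : Fin n) (g : (Fin n → ℝ) → ℝ) :
    ∫ x : E n, g (fun i => if i = s then - x i else x i) ∂(unif (lpBall n p)) =
      ∫ x : E n, g (fun i => x i) ∂(unif (lpBall n p)) := by
  let T : E n ≃ₗᵢ[ℝ] E n := LinearIsometryEquiv.piLpCongrRight 2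
    (fun j : Fin n => if j = s then LinearIsometryEquiv.neg ℝ else LinearIsometryEquiv.refl ℝ ℝ)
  have hT : ∀ x i, T x i = if i = s then - x i else x i := by
    intro x i
    simp only [T, LinearIsometryEquiv.piLpCongrRight_apply]
    split_ifs <;> simp
  have := integral_unif_comp (K := lpBall n p) T
    (by
      intro x
      simp only [lpBall, Set.mem_ofPred_eq, hT]
      have : ∀ i, |if i = s then - x i else x i| = |x i| := by
        intro i; split_ifs <;> simp
      simp only [this]) (fun x => g (fun i => x i))
  rw [← this]
  simp only [hT]

def M4 (n : ℕ) (p : ℝ) (i j k l : Fin n) : ℝ :=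
  ∫ x : E n, x i * x j * x k * x l ∂(unif (lpBall n p))

def M2 (n : ℕ) (p : ℝ) (i j : Fin n) : ℝ :=
  ∫ x : E n, x i * x j ∂(unif (lpBall n p))

theorem M4_perm {n : ℕ} {p : ℝ} (σ : Equiv.Perm (Fin n)) (i j k l : Fin n) :
    M4 n p (σ i) (σ j) (σ k) (σ l) = M4 n p i j k l :=
  integral_perm σ (fun x => x i * x j * x k * x l)

theorem M2_perm {n : ℕ} {p : ℝ} (σ : Equiv.Perm (Fin n)) (i j : Fin n) :
    M2 n p (σ i) (σ j) = M2 n p i j :=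
  integral_perm σ (fun x => x i * x j)

def sg {n : ℕ} (s i : Fin n) : ℝ := if i = s then -1 else 1

theorem M4_sign {n : ℕ} {p : ℝ} (s i j k l : Fin n) :
    sg s i * sg s j * sg s k * sg s l * M4 n p i j k l = M4 n p i j k l := by
  have := integral_sign (p := p) s (fun x => x i * x j * x k * x l)
  unfold M4
  rw [← integral_const_mul]
  refine Eq.trans ?_ this
  congr 1
  ext x
  unfold sg
  beta_reduce
  split_ifs <;> ring

theorem M2_sign {n : ℕ} {p : ℝ} (s i j : Fin n) :
    sg s i * sg s j * M2 n p i j = M2 n p i j := by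
  have := integral_sign (p := p) s (fun x => x i * x j)
  unfold M2
  rw [← integral_const_mul]
  refine Eq.trans ?_ this
  congr 1
  ext x
  unfold sg
  beta_reduce
  split_ifs <;> ring

theorem M2_eq {m : ℕ} {p : ℝ} (i j : Fin (m + 2)) :
    M2 (m + 2) p i j = if i = j then M2 (m + 2) p 0 0 else 0 := by
  split_ifs with h
  · subst h
    have := M2_perm (p := p) (Equiv.swap 0 i) 0 0
    simpa using this
  · have := M2_sign (p := p) i i j
    simp [sg, Ne.symm h] at this
    linarith

theorem exists_perm {m : ℕ} {i j : Fin (m + 2)} (h : i ≠ j) :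
    ∃ σ : Equiv.Perm (Fin (m + 2)), σ 0 = i ∧ σ 1 = j := by
  refine ⟨(Equiv.swap 0 i).trans (Equiv.swap (Equiv.swap 0 i 1) j), ?_, ?_⟩
  · simp only [Equiv.trans_apply, Equiv.swap_apply_left]
    apply Equiv.swap_apply_of_ne_of_ne _ h
    intro h2
    have : Equiv.swap 0 i 0 = Equiv.swap 0 i 1 := by rw [← h2]; simp
    have := (Equiv.swap 0 i).injective this
    simp at this
  · simp

theorem M4_pair {m : ℕ} {p : ℝ} {i j : Fin (m + 2)} (h : i ≠ j) :
    M4 (m + 2) p i i j j = M4 (m + 2) p 0 0 1 1 := by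
  obtain ⟨σ, rfl, rfl⟩ := exists_perm h
  exact M4_perm σ 0 0 1 1

theorem M4_diag {m : ℕ} {p : ℝ} (i : Fin (m + 2)) :
    M4 (m + 2) p i i i i = M4 (m + 2) p 0 0 0 0 := by
  have := M4_perm (p := p) (Equiv.swap 0 i) 0 0 0 0
  simpa using this

theorem M4_swap23 {n : ℕ} {p : ℝ} (i j k l : Fin n) : M4 n p i j k l = M4 n p i k j l := by
  unfold M4; congr 1; ext x; ring

theorem M4_swap24 {n : ℕ} {p : ℝ} (i j k l : Fin n) : M4 n p i j k l = M4 n p i l k j := by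
  unfold M4; congr 1; ext x; ring

theorem M4_eq {m : ℕ} {p : ℝ} (i j k l : Fin (m + 2)) :
    M4 (m + 2) p i j k l =
      (M4 (m + 2) p 0 0 0 0 - 3 * M4 (m + 2) p 0 0 1 1) *
        ((if i = j then 1 else 0) * (if i = k then 1 else 0) * (if i = l then 1 else 0)) +
      M4 (m + 2) p 0 0 1 1 *
        ((if i = j then 1 else 0) * (if k = l then 1 else 0) +
         (if i = k then 1 else 0) * (if j = l then 1 else 0) +
         (if i = l then 1 else 0) * (if j = k then 1 else 0)) := by
  have h1 := M4_sign (p := p) i i j k l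
  have h2 := M4_sign (p := p) j i j k l
  have h3 := M4_sign (p := p) k i j k l
  have h4 := M4_sign (p := p) l i j k l
  by_cases hij : i = j
  · subst hij
    by_cases hkl : k = l
    · subst hkl
      by_cases hik : i = k
      · subst hik
        simp [M4_diag]; ring
      · simp [hik, M4_pair hik]
    · by_cases hik : i = k
      · subst hik
        simp [sg, hkl, Ne.symm hkl] at h1 h2 h3 h4 ⊢
        linarith
      · by_cases hil : i = l
        · subst hil
          simp [sg, hkl, Ne.symm hkl] at h1 h2 h3 h4 ⊢
          linarith
        · simp [sg, hkl, Ne.symm hkl, hik, hil, Ne.symm hik, Ne.symm hil] at h1 h2 h3 h4 ⊢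
          linarith
  · by_cases hik : i = k
    · subst hik
      by_cases hjl : j = l
      · subst hjl
        rw [M4_swap23, M4_pair hij]
        simp [hij]
      · simp only [sg] at h1 h2 h3 h4
        by_cases hil : i = l
        · subst hil
          simp [hij, Ne.symm hij] at h1 h2 h3 h4 ⊢
          linarith
        · simp [hij, Ne.symm hij, hil, Ne.symm hil, hjl, Ne.symm hjl] at h1 h2 h3 h4 ⊢
          linarith
    · by_cases hil : i = l
      · subst hil
        by_cases hjk : j = k
        · subst hjk
          rw [M4_swap24, M4_pair hij]
          simp [hij]
        · simp [sg, hij, Ne.symm hij, hik, Ne.symm hik, hjk, Ne.symm hjk] at h1 h2 h3 h4 ⊢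
          linarith
      · simp [sg, hij, Ne.symm hij, hik, Ne.symm hik, hil, Ne.symm hil] at h1 ⊢
        linarith

theorem inner_expand {n : ℕ} (x a : E n) : ⟪x, a⟫ = ∑ i, a i * x i := by
  simp [PiLp.inner_apply]

theorem int2 {m : ℕ} {p : ℝ} (hp : 1 ≤ p) (a : E (m + 2)) (ha : ∑ i, a i ^ 2 = 1) :
    ∫ x, ⟪x, a⟫ ^ 2 ∂(unif (lpBall (m + 2) p)) = M2 (m + 2) p 0 0 := by
  have e : ∀ x : E (m + 2), ⟪x, a⟫ ^ 2 = ∑ i, ∑ j, (a i * a j) * (x i * x j) := by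
    intro x
    rw [inner_expand, sq, Finset.sum_mul_sum]
    refine Finset.sum_congr rfl fun i _ => Finset.sum_congr rfl fun j _ => by ring
  simp only [e]
  rw [integral_finsetSum _ (fun i _ => integrable_finsetSum _
    fun j _ => (integrable_prod2 hp i j).const_mul _)]
  have : ∀ i, ∫ x : E (m + 2), ∑ j, (a i * a j) * (x i * x j) ∂(unif (lpBall (m + 2) p)) =
      a i ^ 2 * M2 (m + 2) p 0 0 := by
    intro i
    rw [integral_finsetSum _ (fun j _ => (integrable_prod2 hp i j).const_mul _)]
    simp only [integral_const_mul]
    change ∑ j, a i * a j * M2 (m + 2) p i j = _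
    simp only [M2_eq i]
    simp only [mul_ite, mul_zero, Finset.sum_ite_eq, Finset.mem_univ, if_true]
    ring
  simp only [this]
  rw [← Finset.sum_mul, ha, one_mul]

theorem int4 {m : ℕ} {p : ℝ} (hp : 1 ≤ p) (a b : E (m + 2)) (ha : ∑ i, a i ^ 2 = 1)
    (hb : ∑ i, b i ^ 2 = 1) (hab : ∑ i, a i * b i = 0) :
    ∫ x, ⟪x, a⟫ ^ 2 * ⟪x, b⟫ ^ 2 ∂(unif (lpBall (m + 2) p)) =
      (M4 (m + 2) p 0 0 0 0 - 3 * M4 (m + 2) p 0 0 1 1) * ∑ i, (a i * b i) ^ 2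
        + M4 (m + 2) p 0 0 1 1 := by
  have e : ∀ x : E (m + 2), ⟪x, a⟫ ^ 2 * ⟪x, b⟫ ^ 2 =
      ∑ i, ∑ j, ∑ k, ∑ l, (a i * a j * b k * b l) * (x i * x j * x k * x l) := by
    intro x
    have e2 : ∀ a : E (m + 2), ⟪x, a⟫ ^ 2 = ∑ i, ∑ j, (a i * a j) * (x i * x j) := by
      intro a
      rw [inner_expand, sq, Finset.sum_mul_sum]
      refine Finset.sum_congr rfl fun i _ => Finset.sum_congr rfl fun j _ => by ring
    rw [e2 a, e2 b, Finset.sum_mul]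
    refine Finset.sum_congr rfl fun i _ => ?_
    rw [Finset.sum_mul]
    refine Finset.sum_congr rfl fun j _ => ?_
    rw [Finset.mul_sum]
    refine Finset.sum_congr rfl fun k _ => ?_
    rw [Finset.mul_sum]
    exact Finset.sum_congr rfl fun l _ => by ring
  have i1 : ∀ i j k l, Integrable (fun x : E (m + 2) =>
      (a i * a j * b k * b l) * (x i * x j * x k * x l)) (unif (lpBall (m + 2) p)) :=
    fun i j k l => (integrable_prod4 hp i j k l).const_mul _
  have i2 := fun i j k => integrable_finsetSum Finset.univ fun l _ => i1 i j k l
  have i3 := fun i j => integrable_finsetSum Finset.univ fun k _ => i2 i j k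
  have i4 := fun i => integrable_finsetSum Finset.univ fun j _ => i3 i j
  simp only [e]
  rw [integral_finsetSum _ (fun i _ => i4 i)]
  have s1 : ∀ i, ∫ x : E (m + 2), ∑ j, ∑ k, ∑ l,
      (a i * a j * b k * b l) * (x i * x j * x k * x l) ∂(unif (lpBall (m + 2) p)) =
      ∑ j, ∑ k, ∑ l, (a i * a j * b k * b l) * M4 (m + 2) p i j k l := by
    intro i
    rw [integral_finsetSum _ (fun j _ => i3 i j)]
    refine Finset.sum_congr rfl fun j _ => ?_
    rw [integral_finsetSum _ (fun k _ => i2 i j k)]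
    refine Finset.sum_congr rfl fun k _ => ?_
    rw [integral_finsetSum _ (fun l _ => i1 i j k l)]
    refine Finset.sum_congr rfl fun l _ => ?_
    rw [integral_const_mul]
    rfl
  simp only [s1]
  generalize hB : M4 (m + 2) p 0 0 1 1 = B
  generalize hA : M4 (m + 2) p 0 0 0 0 = A
  have s2 : ∀ i j k l, (a i * a j * b k * b l) * M4 (m + 2) p i j k l =
      (if i = l then (if i = k then (if i = j then (A - 3 * B) * (a i * a j * b k * b l) else 0)
        else 0) else 0)
      + (if k = l then (if i = j then B * (a i * a j * b k * b l) else 0) else 0)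
      + (if j = l then (if i = k then B * (a i * a j * b k * b l) else 0) else 0)
      + (if i = l then (if j = k then B * (a i * a j * b k * b l) else 0) else 0) := by
    intro i j k l
    rw [M4_eq, hA, hB]
    split_ifs <;> ring
  simp only [s2, Finset.sum_add_distrib, Finset.sum_ite_eq, Finset.mem_univ, if_true]
  have t1 : ∑ i, ∑ j, ∑ k, (if i = j then B * (a i * a j * b k * b k) else 0) = B := by
    have q : ∀ i j, ∑ k, (if i = j then B * (a i * a j * b k * b k) else 0) =
        if i = j then B * (a i * a j) else 0 := by
      intro i j
      split_ifs
      · calc _ = B * (a i * a j) * ∑ k, b k ^ 2 := by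
              rw [Finset.mul_sum]
              exact Finset.sum_congr rfl fun k _ => by ring
          _ = _ := by rw [hb, mul_one]
      · simp
    simp only [q, Finset.sum_ite_eq, Finset.mem_univ, if_true]
    rw [← Finset.mul_sum]
    simp only [← sq]
    rw [ha, mul_one]
  have t2 : ∑ i, ∑ j, B * (a i * a j * b i * b j) = 0 := by
    have : ∀ i, ∑ j, B * (a i * a j * b i * b j) = B * (a i * b i) * ∑ j, a j * b j := by
      intro i
      rw [Finset.mul_sum]
      exact Finset.sum_congr rfl fun j _ => by ring
    simp [this, hab]
  have t3 : ∑ i, ∑ j, B * (a i * a j * b j * b i) = 0 := by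
    rw [← t2]
    exact Finset.sum_congr rfl fun i _ => Finset.sum_congr rfl fun j _ => by ring
  rw [t1, t2, t3, Finset.mul_sum]
  simp only [add_zero]
  congr 1
  exact Finset.sum_congr rfl fun i _ => by ring


theorem sum_c_sq {n : ℕ} (a b : E n) (ha : ∑ i, a i ^ 2 = 1)
    (hb : ∑ i, b i ^ 2 = 1) (hab : ∑ i, a i * b i = 0) : ∑ i, (a i * b i) ^ 2 ≤ 1 / 2 := by
  have h1 : ∑ i, |a i * b i| ≤ 1 := by
    have : ∑ i, |a i * b i| ≤ ∑ i, (a i ^ 2 + b i ^ 2) / 2 := by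
      refine Finset.sum_le_sum fun i _ => ?_
      rw [abs_mul, ← sq_abs (a i), ← sq_abs (b i)]
      nlinarith [sq_nonneg (|a i| - |b i|)]
    rw [← Finset.sum_div, Finset.sum_add_distrib, ha, hb] at this
    linarith
  have h2 : ∀ i, |a i * b i| ≤ 1 / 2 := by
    intro i
    rw [← Finset.add_sum_erase _ _ (Finset.mem_univ i)] at h1 hab
    have h3 := Finset.abs_sum_le_sum_abs (fun i => a i * b i) (Finset.univ.erase i)
    have h4 : ∑ j ∈ Finset.univ.erase i, a j * b j = - (a i * b i) := by linarith
    rw [h4, abs_neg] at h3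
    linarith
  calc ∑ i, (a i * b i) ^ 2 ≤ ∑ i, 1 / 2 * |a i * b i| := by
        refine Finset.sum_le_sum fun i _ => ?_
        rw [← sq_abs, sq]
        exact mul_le_mul_of_nonneg_right (h2 i) (abs_nonneg _)
    _ = 1 / 2 * ∑ i, |a i * b i| := by rw [Finset.mul_sum]
    _ ≤ 1 / 2 := by linarith

theorem sqrt_two_inv_sq : ((Real.sqrt 2)⁻¹) * (Real.sqrt 2)⁻¹ = 1 / 2 := by
  rw [← sq, inv_pow, Real.sq_sqrt (by norm_num)]; norm_num

/-- the map `(x₀,x₁) ↦ ((x₀+x₁)/√2, (x₀-x₁)/√2)`, other coordinates fixed -/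
def rotFun {m : ℕ} (x : E (m + 2)) : E (m + 2) :=
  WithLp.toLp 2 (Fin.cons ((Real.sqrt 2)⁻¹ * (x 0 + x 1))
    (Fin.cons ((Real.sqrt 2)⁻¹ * (x 0 - x 1)) (fun i => x i.succ.succ)))

theorem rotFun_zero {m : ℕ} (x : E (m + 2)) : rotFun x 0 = (Real.sqrt 2)⁻¹ * (x 0 + x 1) := rfl
theorem rotFun_one {m : ℕ} (x : E (m + 2)) : rotFun x 1 = (Real.sqrt 2)⁻¹ * (x 0 - x 1) := rfl
theorem rotFun_ss {m : ℕ} (x : E (m + 2)) (i : Fin m) : rotFun x i.succ.succ = x i.succ.succ := rfl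

theorem ext_two {m : ℕ} {x y : E (m + 2)} (h0 : x 0 = y 0) (h1 : x 1 = y 1)
    (h : ∀ i : Fin m, x i.succ.succ = y i.succ.succ) : x = y := by
  ext i
  refine Fin.cases h0 (fun j => ?_) i
  exact Fin.cases h1 h j

def rotLin {m : ℕ} : E (m + 2) →ₗ[ℝ] E (m + 2) where
  toFun := rotFun
  map_add' x y := by
    apply ext_two
    · simp only [rotFun_zero, PiLp.add_apply]; ring
    · simp only [rotFun_one, PiLp.add_apply]; ring
    · intro i; simp only [rotFun_ss, PiLp.add_apply]
  map_smul' c x := by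
    apply ext_two
    · simp only [rotFun_zero, PiLp.smul_apply, smul_eq_mul, RingHom.id_apply]; ring
    · simp only [rotFun_one, PiLp.smul_apply, smul_eq_mul, RingHom.id_apply]; ring
    · intro i; simp only [rotFun_ss, PiLp.smul_apply, RingHom.id_apply]

theorem rot_invol {m : ℕ} : Function.Involutive (rotLin (m := m)) := by
  intro x
  have h := sqrt_two_inv_sq
  change rotFun (rotFun x) = x
  apply ext_two
  · simp only [rotFun_zero, rotFun_one]
    linear_combination (2 * x 0) * h
  · simp only [rotFun_zero, rotFun_one]
    linear_combination (2 * x 1) * h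
  · intro i; simp only [rotFun_ss]

theorem sum_two {m : ℕ} (f : Fin (m + 2) → ℝ) :
    ∑ i, f i = f 0 + f 1 + ∑ i : Fin m, f i.succ.succ := by
  rw [Fin.sum_univ_succ, Fin.sum_univ_succ]
  exact (add_assoc _ _ _).symm

def rot {m : ℕ} : E (m + 2) ≃ₗᵢ[ℝ] E (m + 2) where
  toLinearEquiv := LinearEquiv.ofInvolutive rotLin rot_invol
  norm_map' x := by
    have h := sqrt_two_inv_sq
    change ‖rotFun x‖ = ‖x‖
    rw [EuclideanSpace.norm_eq, EuclideanSpace.norm_eq]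
    congr 1
    simp only [Real.norm_eq_abs, sq_abs]
    rw [sum_two, sum_two (fun i => x i ^ 2)]
    simp only [rotFun_zero, rotFun_one, rotFun_ss]
    linear_combination (2 * x 0 ^ 2 + 2 * x 1 ^ 2) * h

def hh {m : ℕ} (x : E (m + 2)) : ℝ := x 0 ^ 4 + x 1 ^ 4 - 6 * x 0 ^ 2 * x 1 ^ 2

theorem hh_rot {m : ℕ} (x : E (m + 2)) : hh (rotFun x) = - hh x := by
  have h := sqrt_two_inv_sq
  have h4 : ((Real.sqrt 2)⁻¹) ^ 4 = 1 / 4 := by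
    calc ((Real.sqrt 2)⁻¹) ^ 4 = ((Real.sqrt 2)⁻¹ * (Real.sqrt 2)⁻¹) ^ 2 := by ring
      _ = 1 / 4 := by rw [h]; norm_num
  unfold hh
  simp only [rotFun_zero, rotFun_one]
  linear_combination ((x 0 + x 1) ^ 4 + (x 0 - x 1) ^ 4
    - 6 * (x 0 + x 1) ^ 2 * (x 0 - x 1) ^ 2) * h4

theorem hh_pos_mem {m : ℕ} {p : ℝ} (hp1 : 1 ≤ p) (hp2 : p ≤ 2) {x : E (m + 2)} (h : 0 ≤ hh x)
    (hx : rotFun x ∈ lpBall (m + 2) p) : x ∈ lpBall (m + 2) p := by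
  unfold lpBall at *
  rw [Set.mem_ofPred_eq, sum_two] at *
  simp only [rotFun_ss] at hx
  have := aux_pair (by linarith) hp2 (rotFun_zero x) (rotFun_one x) h
  linarith

theorem hh_int_nonneg {m : ℕ} {p : ℝ} (hp1 : 1 ≤ p) (hp2 : p ≤ 2) :
    0 ≤ ∫ x, hh x ∂(unif (lpBall (m + 2) p)) := by
  unfold unif
  rw [integral_smul_measure]
  apply smul_nonneg ENNReal.toReal_nonneg
  have hK := (lpBall_closed (m + 2) p hp1).measurableSet
  have hKc : IsCompact (lpBall (m + 2) p) := by
    apply Metric.isCompact_of_isClosed_isBounded (lpBall_closed _ p hp1)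
    refine (Metric.isBounded_closedBall (x := (0 : E (m + 2))) (r := √(m + 2))).subset ?_
    intro x hx
    rw [mem_closedBall_zero_iff, EuclideanSpace.norm_eq]
    apply Real.sqrt_le_sqrt
    calc ∑ i, ‖x i‖ ^ 2 ≤ ∑ i : Fin (m + 2), (1 : ℝ) := by
          refine Finset.sum_le_sum fun i _ => ?_
          have := lpBall_coord hp1 hx i
          rw [Real.norm_eq_abs]
          exact pow_le_one₀ (abs_nonneg _) this
      _ = _ := by simp
  have hcont : Continuous (hh (m := m)) := by unfold hh; fun_prop
  have hint : Integrable ((lpBall (m + 2) p).indicator hh) (volume : Measure (E (m + 2))) := by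
    rw [integrable_indicator_iff hK]
    exact hcont.continuousOn.integrableOn_compact hKc
  rw [← integral_indicator hK]
  have hmp := (rot (m := m)).measurePreserving
  have hemb := (rot (m := m)).toHomeomorph.measurableEmbedding
  have e1 := hmp.integral_comp hemb ((lpBall (m + 2) p).indicator hh)
  have hint2 : Integrable (fun x => (lpBall (m + 2) p).indicator hh (rot x))
      (volume : Measure (E (m + 2))) := (hmp.integrable_comp_emb hemb (g := (lpBall (m + 2) p).indicator hh)).mpr hint
  have e2 : 0 ≤ ∫ x, ((lpBall (m + 2) p).indicator hh x
      + (lpBall (m + 2) p).indicator hh (rot x)) := by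
    apply integral_nonneg
    intro x
    change 0 ≤ (lpBall (m + 2) p).indicator hh x + (lpBall (m + 2) p).indicator hh (rotFun x)
    have hr := hh_rot x
    have hrr : rotFun (rotFun x) = x := rot_invol x
    by_cases h1 : x ∈ lpBall (m + 2) p <;> by_cases h2 : rotFun x ∈ lpBall (m + 2) p <;>
      simp only [h1, h2, Set.indicator_of_mem, Set.indicator_of_notMem, not_false_eq_true]
    · linarith
    · by_contra hneg
      push Not at hneg
      exact h2 (hh_pos_mem hp1 hp2 (by linarith) (by rwa [hrr]))
    · by_contra hneg
      push Not at hneg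
      exact h1 (hh_pos_mem hp1 hp2 (by linarith) h2)
    · simp
  rw [integral_add hint hint2, e1] at e2
  linarith

theorem M4_ineq {m : ℕ} {p : ℝ} (hp1 : 1 ≤ p) (hp2 : p ≤ 2) :
    0 ≤ M4 (m + 2) p 0 0 0 0 - 3 * M4 (m + 2) p 0 0 1 1 := by
  have h := hh_int_nonneg (m := m) hp1 hp2
  have e : ∀ x : E (m + 2), hh x = x 0 * x 0 * x 0 * x 0 + x 1 * x 1 * x 1 * x 1
      - 6 * (x 0 * x 0 * x 1 * x 1) := by
    intro x; unfold hh; ring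
  simp only [e] at h
  have ia : Integrable (fun x : E (m + 2) => x 0 * x 0 * x 0 * x 0 + x 1 * x 1 * x 1 * x 1)
      (unif (lpBall (m + 2) p)) :=
    (integrable_prod4 hp1 0 0 0 0).add (integrable_prod4 hp1 1 1 1 1)
  rw [integral_sub ia ((integrable_prod4 hp1 0 0 1 1).const_mul 6),
    integral_add (integrable_prod4 hp1 0 0 0 0) (integrable_prod4 hp1 1 1 1 1),
    integral_const_mul] at h
  change 0 ≤ M4 (m + 2) p 0 0 0 0 + M4 (m + 2) p 1 1 1 1 - 6 * M4 (m + 2) p 0 0 1 1 at h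
  rw [M4_diag 1] at h
  linarith

theorem covf_eq {m : ℕ} {p : ℝ} (hp : 1 ≤ p) (a b : E (m + 2)) (ha : ∑ i, a i ^ 2 = 1)
    (hb : ∑ i, b i ^ 2 = 1) (hab : ∑ i, a i * b i = 0) :
    covf (unif (lpBall (m + 2) p)) a b =
      (M4 (m + 2) p 0 0 0 0 - 3 * M4 (m + 2) p 0 0 1 1) * ∑ i, (a i * b i) ^ 2
        + M4 (m + 2) p 0 0 1 1 - M2 (m + 2) p 0 0 * M2 (m + 2) p 0 0 := by
  unfold covf
  rw [int4 hp a b ha hb hab, int2 hp a ha, int2 hp b hb]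

theorem main_aux (m : ℕ) (p : ℝ) (hp1 : 1 ≤ p) (hp2 : p ≤ 2)
    (a b : E (m + 2)) (ha : ‖a‖ = 1) (hb : ‖b‖ = 1) (hab : ⟪a, b⟫ = 0) :
    covf (unif (lpBall (m + 2) p)) (stdb 0) (stdb 1) ≤ covf (unif (lpBall (m + 2) p)) a b ∧
    covf (unif (lpBall (m + 2) p)) a b ≤
      covf (unif (lpBall (m + 2) p))
        ((Real.sqrt 2)⁻¹ • (stdb 0 + stdb 1)) ((Real.sqrt 2)⁻¹ • (stdb 0 - stdb 1)) := by
  have nrm : ∀ x : E (m + 2), ‖x‖ = 1 → ∑ i, x i ^ 2 = 1 := by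
    intro x hx
    have := EuclideanSpace.norm_sq_eq x
    rw [hx] at this
    simp only [Real.norm_eq_abs, sq_abs] at this
    linarith
  have ha' := nrm a ha
  have hb' := nrm b hb
  have hab' : ∑ i, a i * b i = 0 := by
    rw [inner_expand] at hab
    rw [← hab]
    exact Finset.sum_congr rfl fun i _ => mul_comm _ _
  have h := sqrt_two_inv_sq
  have hs : ∀ i : Fin m, (i.succ.succ : Fin (m + 2)) ≠ 1 := by
    intro i hi
    have := congrArg Fin.val hi
    simp at this
  have z0 : (stdb 0 : E (m + 2)) 0 = 1 := by simp [stdb]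
  have z1 : (stdb 0 : E (m + 2)) 1 = 0 := by simp [stdb]
  have z2 : ∀ i : Fin m, (stdb 0 : E (m + 2)) i.succ.succ = 0 := by intro i; simp [stdb]
  have o0 : (stdb 1 : E (m + 2)) 0 = 0 := by simp [stdb]
  have o1 : (stdb 1 : E (m + 2)) 1 = 1 := by simp [stdb]
  have o2 : ∀ i : Fin m, (stdb 1 : E (m + 2)) i.succ.succ = 0 := by intro i; simp [stdb, hs i]
  have hM := M4_ineq (m := m) hp1 hp2
  rw [covf_eq hp1 a b ha' hb' hab',
    covf_eq hp1 (stdb 0) (stdb 1) (by simp [sum_two, z0, z1, z2])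
      (by simp [sum_two, o0, o1, o2]) (by simp [sum_two, z0, z1, z2, o0, o1, o2]),
    covf_eq hp1 ((Real.sqrt 2)⁻¹ • (stdb 0 + stdb 1)) ((Real.sqrt 2)⁻¹ • (stdb 0 - stdb 1))
      (by
        rw [sum_two]
        simp only [PiLp.smul_apply, PiLp.add_apply, smul_eq_mul, z0, z1, z2, o0, o1, o2]
        simp only [add_zero, zero_add, mul_zero, mul_one, sq, h, Finset.sum_const_zero]
        norm_num)
      (by
        rw [sum_two]
        simp only [PiLp.smul_apply, PiLp.sub_apply, smul_eq_mul, z0, z1, z2, o0, o1, o2]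
        simp only [sub_zero, zero_sub, mul_zero, mul_one, sq, h, Finset.sum_const_zero,
          mul_neg, neg_mul, neg_neg]
        norm_num)
      (by
        rw [sum_two]
        simp only [PiLp.smul_apply, PiLp.add_apply, PiLp.sub_apply, smul_eq_mul,
          z0, z1, z2, o0, o1, o2]
        simp)]
  have q1 : ∑ i, ((stdb 0 : E (m + 2)) i * (stdb 1 : E (m + 2)) i) ^ 2 = 0 := by
    simp [sum_two, z0, z1, z2, o0, o1, o2]
  have q2 : ∑ i, (((Real.sqrt 2)⁻¹ • (stdb 0 + stdb 1) : E (m + 2)) i *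
      ((Real.sqrt 2)⁻¹ • (stdb 0 - stdb 1) : E (m + 2)) i) ^ 2 = 1 / 2 := by
    rw [sum_two]
    simp only [PiLp.smul_apply, PiLp.add_apply, PiLp.sub_apply, smul_eq_mul,
      z0, z1, z2, o0, o1, o2]
    simp only [add_zero, zero_add, sub_zero, zero_sub, mul_zero, mul_one, h, mul_neg, neg_mul,
      Finset.sum_const_zero]
    norm_num
  rw [q1, q2]
  have q3 := sum_c_sq a b ha' hb' hab'
  have q4 : 0 ≤ ∑ i, (a i * b i) ^ 2 := Finset.sum_nonneg fun i _ => sq_nonneg _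
  have q5 := mul_le_mul_of_nonneg_left q3 hM
  have q6 := mul_nonneg hM q4
  constructor <;> linarith

/-- For `1 ≤ p ≤ 2`, the extremal pairs of `f` on `B_p^n` are
`(e₁,e₂)` (minimum) and `(ξ₁,ξ₂) = ((e₁+e₂)/√2, (e₁-e₂)/√2)` (maximum). -/
theorem sncp_Bpn_extremal_pairs_p_le_two
    (n : ℕ) (hn : 2 ≤ n) (p : ℝ) (hp1 : 1 ≤ p) (hp2 : p ≤ 2)
    (η₁ η₂ : E n) (hη₁ : ‖η₁‖ = 1) (hη₂ : ‖η₂‖ = 1) (hortho : ⟪η₁, η₂⟫ = 0) :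
    covf (unif (lpBall n p)) (stdb (⟨0, by omega⟩ : Fin n)) (stdb ⟨1, by omega⟩) ≤
      covf (unif (lpBall n p)) η₁ η₂ ∧
    covf (unif (lpBall n p)) η₁ η₂ ≤
      covf (unif (lpBall n p))
        ((Real.sqrt 2)⁻¹ • (stdb (⟨0, by omega⟩ : Fin n) + stdb ⟨1, by omega⟩))
        ((Real.sqrt 2)⁻¹ • (stdb (⟨0, by omega⟩ : Fin n) - stdb ⟨1, by omega⟩)) := by
  obtain ⟨m, rfl⟩ : ∃ m, n = m + 2 := ⟨n - 2, by omega⟩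
  exact main_aux m p hp1 hp2 η₁ η₂ hη₁ hη₂ hortho
end
end

section
/- Let 1 ≤ p < 2. There exists n0(p) ∈ ℕ such that for every n ≥ n0(p), if X is a random vector uniformly distributed on the ℓ_p unit ball B_p^n, then there exists an orthonormal basis {η_i}_{i=1}^n of ℝ^n with respect to which X does not satisfy the square negative correlation property; in particular there exist orthonormal vectors η1, η2 with E[⟨X,η1⟩²⟨X,η2⟩²] > E[⟨X,η1⟩²]·E[⟨X,η2⟩²]. -/
open MeasureTheory Real
open scoped RealInnerProductSpace ENNReal

noncomputable section

/-- factor in the Euler product of `Γ(5x)Γ(x)/Γ(3x)²` -/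
def qf (x : ℝ) (j : ℕ) : ℝ := (3*x+j)^2 / ((5*x+j)*(x+j))

lemma gammaSeq_ratio {x : ℝ} (hx : 0 < x) {n : ℕ} (hn : 1 ≤ n) :
    Real.GammaSeq (5*x) n * Real.GammaSeq x n / (Real.GammaSeq (3*x) n)^2
      = ∏ j ∈ Finset.range (n+1), qf x j := by
  have hn' : (0:ℝ) < n := by exact_mod_cast hn
  simp only [Real.GammaSeq, qf]
  rw [Finset.prod_div_distrib, Finset.prod_mul_distrib, Finset.prod_pow]
  have h5 : (0:ℝ) < ∏ j ∈ Finset.range (n+1), (5*x+j) := Finset.prod_pos fun j _ => by positivity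
  have h3 : (0:ℝ) < ∏ j ∈ Finset.range (n+1), (3*x+j) := Finset.prod_pos fun j _ => by positivity
  have h1 : (0:ℝ) < ∏ j ∈ Finset.range (n+1), (x+j) := Finset.prod_pos fun j _ => by positivity
  have e : ((n:ℝ)^(3*x))^2 = (n:ℝ)^(5*x) * (n:ℝ)^x := by
    rw [pow_two, ← Real.rpow_add hn', ← Real.rpow_add hn']; ring_nf
  have hf : (0:ℝ) < (n.factorial : ℝ) := by positivity
  have hA : (0:ℝ) < (n:ℝ)^(5*x) := by positivity
  have hB : (0:ℝ) < (n:ℝ)^(x) := by positivity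
  rw [div_pow, mul_pow, e]
  field_simp

lemma qf_half_pos (j : ℕ) {x : ℝ} (hx : 0 < x) : 0 < qf x j := by
  unfold qf; positivity

lemma qf_mono {x : ℝ} (hx : 1/2 < x) (j : ℕ) : qf (1/2) j ≤ qf x j := by
  unfold qf
  have hj : (0:ℝ) ≤ j := by positivity
  rw [div_le_div_iff₀ (by positivity) (by positivity)]
  have key : 0 ≤ (x-1/2) * (j:ℝ)*((j:ℝ)*(x+1/2) + 6*x*(1/2)) := by
    have : 0 ≤ x - 1/2 := by linarith
    positivity
  nlinarith [key]

lemma qf_one {x : ℝ} (hx : 1/2 < x) : qf (1/2) 1 < qf x 1 := by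
  unfold qf
  rw [div_lt_div_iff₀ (by positivity) (by positivity)]
  have key : 0 < (x-1/2) * ((x+1/2) + 6*x*(1/2)) := by
    have : 0 < x - 1/2 := by linarith
    positivity
  push_cast
  nlinarith [key]

lemma qprod {x : ℝ} (hx : 1/2 < x) (n : ℕ) (hn : 1 ≤ n) :
    (qf x 1 / qf (1/2) 1) * ∏ j ∈ Finset.range (n+1), qf (1/2) j ≤ ∏ j ∈ Finset.range (n+1), qf x j := by
  have hx0 : 0 < x := by linarith
  have h2 : (0:ℝ) < 1/2 := by norm_num
  induction n, hn using Nat.le_induction with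
  | base =>
    simp only [Finset.prod_range_succ, Finset.prod_range_zero, one_mul]
    have := qf_half_pos 1 h2
    rw [show qf x 1 / qf (1/2) 1 * (qf (1/2) 0 * qf (1/2) 1) = qf (1/2) 0 * qf x 1 by field_simp]
    exact mul_le_mul_of_nonneg_right (qf_mono hx 0) (qf_half_pos 1 hx0).le
  | succ n hn ih =>
    rw [Finset.prod_range_succ, Finset.prod_range_succ _ (n+1), ← mul_assoc]
    exact mul_le_mul ih (qf_mono hx _) (qf_half_pos _ h2).le
      (Finset.prod_nonneg fun j _ => (qf_half_pos _ hx0).le)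

lemma tendsto_ratio {x : ℝ} (hx : 0 < x) :
    Filter.Tendsto (fun n : ℕ => ∏ j ∈ Finset.range (n+1), qf x j) Filter.atTop
      (nhds (Gamma (5*x) * Gamma x / (Gamma (3*x))^2)) := by
  have h := ((Real.GammaSeq_tendsto_Gamma (5*x)).mul (Real.GammaSeq_tendsto_Gamma x)).div
    ((Real.GammaSeq_tendsto_Gamma (3*x)).pow 2)
    (by have := Real.Gamma_pos_of_pos (s := 3*x) (by positivity); positivity)
  refine h.congr' ?_
  filter_upwards [Filter.eventually_ge_atTop 1] with n hn
  exact gammaSeq_ratio hx hn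

lemma gamma_ineq {x : ℝ} (hx : 1/2 < x) :
    3 * Gamma (3*x)^2 < Gamma (5*x) * Gamma x := by
  have hx0 : 0 < x := by linarith
  have h2 : (0:ℝ) < 1/2 := by norm_num
  have hl := le_of_tendsto_of_tendsto ((tendsto_ratio h2).const_mul (qf x 1 / qf (1/2) 1))
    (tendsto_ratio hx0) (by
      filter_upwards [Filter.eventually_ge_atTop 1] with n hn
      exact qprod hx n hn)
  have hr : 1 < qf x 1 / qf (1/2) 1 := (one_lt_div (qf_half_pos 1 h2)).2 (qf_one hx)
  have hG : (0:ℝ) < Gamma (1/2) := Real.Gamma_pos_of_pos h2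
  have e3 : Gamma (3*(1/2)) = 1/2 * Gamma (1/2) := by
    rw [← Real.Gamma_add_one (by norm_num)]; norm_num
  have e5 : Gamma (5*(1/2)) = 3/2 * (1/2 * Gamma (1/2)) := by
    rw [← e3, show (3*(1/2):ℝ) = 3/2 by norm_num, ← Real.Gamma_add_one (by norm_num)]; norm_num
  have e : Gamma (5*(1/2)) * Gamma (1/2) / (Gamma (3*(1/2)))^2 = 3 := by
    rw [e5, e3]; field_simp
  rw [e] at hl
  have h3 : (0:ℝ) < Gamma (3*x) := Real.Gamma_pos_of_pos (by positivity)
  rw [← lt_div_iff₀ (by positivity)]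
  linarith

lemma gamma_asymp {d : ℝ} (hd : 0 < d) {a : ℝ} (ha : 1 < a) :
    Gamma a * Gamma (a + 2*d) ≤ ((a+2*d)/(a-1))^d * Gamma (a+d)^2 := by
  have hc := Real.convexOn_log_Gamma
  have m : ∀ {y : ℝ}, 0 < y → y ∈ Set.Ioi (0:ℝ) := fun h => h
  have s1 := hc.slope_mono_adjacent (x := a-1) (y := a) (z := a+d) (m (by linarith)) (m (by linarith))
    (by linarith) (by linarith)
  have s2 := hc.slope_mono_adjacent (x := a+d) (y := a+2*d) (z := a+2*d+1) (m (by linarith))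
    (m (by linarith)) (by linarith) (by linarith)
  have g0 := Real.Gamma_pos_of_pos (s := a) (by linarith)
  have g1 := Real.Gamma_pos_of_pos (s := a-1) (by linarith)
  have g2 := Real.Gamma_pos_of_pos (s := a+d) (by linarith)
  have g3 := Real.Gamma_pos_of_pos (s := a+2*d) (by linarith)
  have h1 : Gamma a = (a-1) * Gamma (a-1) := by
    rw [← Real.Gamma_add_one (by linarith)]; ring_nf
  have h2 : Gamma (a+2*d+1) = (a+2*d) * Gamma (a+2*d) := Real.Gamma_add_one (by linarith)
  have l1 : log (Gamma a) = log (a-1) + log (Gamma (a-1)) := by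
    rw [h1, Real.log_mul (by linarith) g1.ne']
  have l2 : log (Gamma (a+2*d+1)) = log (a+2*d) + log (Gamma (a+2*d)) := by
    rw [h2, Real.log_mul (by linarith) g3.ne']
  simp only [Function.comp] at s1 s2
  rw [show a - (a-1) = 1 by ring, show a + d - a = d by ring, div_one, le_div_iff₀ hd] at s1
  rw [show a + 2*d+1 - (a+2*d) = 1 by ring, show a + 2*d - (a+d) = d by ring, div_one,
    div_le_iff₀ hd] at s2
  have hq : 0 < (a+2*d)/(a-1) := div_pos (by linarith) (by linarith)
  rw [← Real.log_le_log_iff (by positivity) (by positivity), Real.log_mul g0.ne' g3.ne',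
    Real.log_mul (by positivity) (by positivity), Real.log_rpow hq, Real.log_pow,
    Real.log_div (by linarith) (by linarith)]
  push_cast
  nlinarith

lemma gamma_eventually {p c : ℝ} (hp : 0 < p) (hc : 1 < c) :
    ∀ᶠ n : ℕ in Filter.atTop,
      Gamma (n/p+1) * Gamma (((n:ℝ)+4)/p+1) < c * Gamma (((n:ℝ)+2)/p+1)^2 := by
  have hd : 0 < 2/p := by positivity
  have ht : Filter.Tendsto (fun n : ℕ => (n:ℝ)/p) Filter.atTop Filter.atTop :=
    tendsto_natCast_atTop_atTop.atTop_div_const hp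
  have h1 : Filter.Tendsto (fun n : ℕ => ((1 + (1+2*(2/p)) / ((n:ℝ)/p)) ^ (2/p))) Filter.atTop (nhds 1) := by
    have : Filter.Tendsto (fun n : ℕ => (1 + (1+2*(2/p)) / ((n:ℝ)/p))) Filter.atTop (nhds (1+0)) :=
      (ht.const_div_atTop _).const_add 1
    have h := this.rpow_const (p := 2/p) (Or.inr hd.le)
    simpa using h
  filter_upwards [h1.eventually_lt_const hc, Filter.eventually_ge_atTop 1] with n hn hn1
  have hn0 : (0:ℝ) < n := by exact_mod_cast hn1
  have hnp : 0 < (n:ℝ)/p := by positivity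
  have h := gamma_asymp hd (a := n/p+1) (by linarith)
  have e : ((n:ℝ)/p+1 + 2*(2/p))/((n:ℝ)/p+1-1) = 1 + (1+2*(2/p)) / ((n:ℝ)/p) := by
    rw [add_sub_cancel_right, add_assoc, add_div, div_self hnp.ne']
  rw [e] at h
  have e4 : (n:ℝ)/p+1 + 2*(2/p) = ((n:ℝ)+4)/p+1 := by ring
  have e2 : (n:ℝ)/p+1 + (2/p) = ((n:ℝ)+2)/p+1 := by ring
  rw [e4, e2] at h
  have g := Real.Gamma_pos_of_pos (s := ((n:ℝ)+2)/p+1) (by positivity)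
  refine h.trans_lt ?_
  gcongr

lemma lint_smul {n : ℕ} (g : (Fin n → ℝ) → ℝ≥0∞) (hg : Measurable g) {t : ℝ} (ht : 0 < t) :
    ∫⁻ x, g x = ENNReal.ofReal (t^n) * ∫⁻ x, g (t • x) := by
  have h := Measure.map_addHaar_smul (volume : Measure (Fin n → ℝ)) ht.ne'
  have h2 : ∫⁻ x, g (t • x) = ∫⁻ x, g x ∂(Measure.map (t • ·) volume) :=
    (lintegral_map hg (measurable_const_smul t)).symm
  have hpos : 0 < t^n := by positivity
  rw [h2, h, lintegral_smul_measure, smul_eq_mul, ← mul_assoc, ← ENNReal.ofReal_mul hpos.le]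
  simp only [Module.finrank_fintype_fun_eq_card, Fintype.card_fin]
  rw [abs_of_pos (by positivity), mul_inv_cancel₀ hpos.ne']
  simp

/-- the p-th power of the norm -/
def Np (n : ℕ) (p : ℝ) (x : Fin n → ℝ) : ℝ := ∑ i, |x i| ^ p

lemma Np_cont {n : ℕ} {p : ℝ} (hp : 0 < p) : Continuous (Np n p) := by
  unfold Np
  refine continuous_finsetSum _ fun i _ => ?_
  exact (continuous_abs.comp (continuous_apply i)).rpow_const fun _ => Or.inr hp.le

lemma Np_nonneg {n : ℕ} {p : ℝ} (x : Fin n → ℝ) : 0 ≤ Np n p x :=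
  Finset.sum_nonneg fun i _ => by positivity

lemma Np_smul {n : ℕ} {p : ℝ} (hp : 0 < p) {s : ℝ} (hs : 0 < s) (x : Fin n → ℝ) :
    Np n p ((s ^ (1/p)) • x) = s * Np n p x := by
  unfold Np
  rw [Finset.mul_sum]
  refine Finset.sum_congr rfl fun i _ => ?_
  have h : 0 < s^(1/p) := by positivity
  rw [Pi.smul_apply, smul_eq_mul, abs_mul, Real.mul_rpow (abs_nonneg _) (abs_nonneg _), abs_of_pos h,
    ← Real.rpow_mul hs.le, one_div_mul_cancel hp.ne', Real.rpow_one]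

lemma exp_layer {u : ℝ} (hu : 0 ≤ u) :
    ENNReal.ofReal (exp (-u)) =
      ∫⁻ s in Set.Ioi (0:ℝ), (Set.Ici u).indicator (fun s => ENNReal.ofReal (exp (-s))) s := by
  rw [lintegral_indicator measurableSet_Ici, Measure.restrict_restrict measurableSet_Ici]
  have h : (Set.Ici u ∩ Set.Ioi 0 : Set ℝ) =ᵐ[volume] Set.Ioi u := by
    rcases hu.eq_or_lt with rfl | hu
    · have e : (Set.Ici 0 ∩ Set.Ioi 0 : Set ℝ) = Set.Ioi 0 :=
        Set.inter_eq_self_of_subset_right Set.Ioi_subset_Ici_self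
      rw [e]
      exact Filter.EventuallyEq.rfl
    · have e : (Set.Ici u ∩ Set.Ioi 0 : Set ℝ) = Set.Ici u :=
        Set.inter_eq_self_of_subset_left (fun x (hx : u ≤ x) => lt_of_lt_of_le hu hx)
      rw [e]
      exact Ioi_ae_eq_Ici.symm
  rw [Measure.restrict_congr_set h, ← ofReal_integral_eq_lintegral_ofReal, integral_exp_neg_Ioi]
  · exact integrableOn_exp_neg_Ioi u
  · exact Filter.Eventually.of_forall fun s => (exp_pos _).le

lemma layer {n : ℕ} {p : ℝ} (hp : 0 < p) (F : (Fin n → ℝ) → ℝ≥0∞) (hF : Measurable F) (k : ℕ)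
    (hom : ∀ t : ℝ, 0 < t → ∀ x, F (t • x) = ENNReal.ofReal (t^k) * F x) :
    ∫⁻ x, F x * ENNReal.ofReal (exp (-Np n p x)) =
      ENNReal.ofReal (Gamma (((n:ℝ)+k)/p+1)) * ∫⁻ x in {x | Np n p x ≤ 1}, F x := by
  have hN : Measurable (Np n p) := (Np_cont hp).measurable
  have hB : MeasurableSet {x | Np n p x ≤ 1} := hN measurableSet_Iic
  have h1 : ∀ x, F x * ENNReal.ofReal (exp (-Np n p x)) =
      ∫⁻ s in Set.Ioi (0:ℝ), F x * {y : (Fin n → ℝ) × ℝ | Np n p y.1 ≤ y.2}.indicator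
        (fun y => ENNReal.ofReal (exp (-y.2))) (x, s) := by
    intro x
    rw [exp_layer (Np_nonneg x), lintegral_const_mul]
    · rfl
    · exact Measurable.indicator (f := fun s : ℝ => ENNReal.ofReal (exp (-s)))
        (s := Set.Ici (Np n p x)) (by fun_prop) measurableSet_Ici
  have hS : MeasurableSet {y : (Fin n → ℝ) × ℝ | Np n p y.1 ≤ y.2} :=
    measurableSet_le (hN.comp measurable_fst) measurable_snd
  simp_rw [h1]
  rw [lintegral_lintegral_swap]
  swap
  · refine Measurable.aemeasurable ?_
    refine (hF.comp measurable_fst).mul ?_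
    exact Measurable.indicator (by fun_prop) hS
  have h2 : ∀ s ∈ Set.Ioi (0:ℝ), (∫⁻ x, F x * {y : (Fin n → ℝ) × ℝ | Np n p y.1 ≤ y.2}.indicator
        (fun y => ENNReal.ofReal (exp (-y.2))) (x, s)) =
      ENNReal.ofReal (exp (-s) * s ^ (((n:ℝ)+k)/p+1-1)) * ∫⁻ x in {x | Np n p x ≤ 1}, F x := by
    intro s hs
    have hs : 0 < s := hs
    have ht : 0 < s^(1/p) := by positivity
    rw [lint_smul _ _ ht]
    swap
    · refine hF.mul ?_
      exact (Measurable.indicator (by fun_prop) hS).comp (measurable_id.prodMk measurable_const)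
    have h3 : ∀ x, F (s^(1/p) • x) * {y : (Fin n → ℝ) × ℝ | Np n p y.1 ≤ y.2}.indicator
        (fun y => ENNReal.ofReal (exp (-y.2))) (s^(1/p) • x, s) =
        ENNReal.ofReal ((s^(1/p))^k * exp (-s)) * {x | Np n p x ≤ 1}.indicator F x := by
      intro x
      rw [hom _ ht, ENNReal.ofReal_mul (by positivity)]
      have : Np n p (s^(1/p) • x) ≤ s ↔ Np n p x ≤ 1 := by
        rw [Np_smul hp hs]; constructor <;> intro h <;> nlinarith
      by_cases hx : Np n p x ≤ 1
      · rw [Set.indicator_of_mem (by exact this.2 hx), Set.indicator_of_mem (by exact hx)]; ring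
      · rw [Set.indicator_of_notMem (by exact fun h => hx (this.1 h)),
          Set.indicator_of_notMem (by exact hx)]; simp
    simp_rw [h3]
    rw [lintegral_const_mul _ (hF.indicator hB), lintegral_indicator hB, ← mul_assoc,
      ← ENNReal.ofReal_mul (by positivity)]
    congr 2
    rw [← Real.rpow_natCast, ← Real.rpow_natCast, ← Real.rpow_mul hs.le, ← Real.rpow_mul hs.le,
      ← mul_assoc, ← Real.rpow_add hs, mul_comm]
    congr 2
    ring
  rw [setLIntegral_congr_fun measurableSet_Ioi h2, lintegral_mul_const]
  swap
  · fun_prop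
  congr 1
  have hpos : 0 < ((n:ℝ)+k)/p+1 := by positivity
  rw [Real.Gamma_eq_integral hpos, ofReal_integral_eq_lintegral_ofReal]
  · exact Real.GammaIntegral_convergent hpos
  · refine (ae_restrict_iff' measurableSet_Ioi).2 (Filter.Eventually.of_forall fun s hs => ?_)
    have hs : 0 < s := hs
    simp only [Pi.zero_apply]
    positivity

/-- one-dimensional moment -/
def Jm (p : ℝ) (k : ℕ) : ℝ := ∫ t : ℝ, |t|^k * exp (-|t|^p)

lemma Jm_eq {p : ℝ} (hp : 0 < p) (k : ℕ) : Jm p k = 2 * (1/p * Gamma (((k:ℝ)+1)/p)) := by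
  have h := integral_comp_abs (f := fun t : ℝ => t^k * exp (-t^p))
  unfold Jm
  rw [h, ← integral_rpow_mul_exp_neg_rpow hp (q := k) (by
    have : (0:ℝ) ≤ k := by positivity
    linarith)]
  simp_rw [Real.rpow_natCast]

lemma Jm_int {p : ℝ} (hp : 1 ≤ p) (k : ℕ) : Integrable fun t : ℝ => |t|^k * exp (-|t|^p) := by
  have hp0 : 0 < p := by linarith
  by_contra h
  have h1 := integral_undef h
  have h2 := Jm_eq hp0 k
  rw [Jm, h1] at h2
  have := Real.Gamma_pos_of_pos (s := ((k:ℝ)+1)/p) (by positivity)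
  have : 0 < 2 * (1/p * Gamma (((k:ℝ)+1)/p)) := by positivity
  linarith

lemma moment {n : ℕ} {p : ℝ} (hp : 1 ≤ p) (k : Fin n → ℕ) :
    ENNReal.ofReal (Gamma (((n:ℝ)+(∑ i, k i : ℕ))/p+1)) *
      ∫⁻ x in {x | Np n p x ≤ 1}, ENNReal.ofReal (∏ i, |x i|^k i) =
    ENNReal.ofReal (∏ i, Jm p (k i)) := by
  have hp0 : 0 < p := by linarith
  rw [← layer hp0]
  · have : ∀ x : Fin n → ℝ, ENNReal.ofReal (∏ i, |x i|^k i) * ENNReal.ofReal (exp (-Np n p x)) =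
        ENNReal.ofReal (∏ i, (|x i|^k i * exp (-|x i|^p))) := by
      intro x
      rw [← ENNReal.ofReal_mul (Finset.prod_nonneg fun i _ => by positivity), Finset.prod_mul_distrib,
        ← Real.exp_sum, Finset.sum_neg_distrib]
      rfl
    simp_rw [this]
    rw [← ofReal_integral_eq_lintegral_ofReal]
    · congr 1
      exact integral_fintype_prod_volume_eq_prod (fun i (t:ℝ) => |t|^k i * exp (-|t|^p))
    · exact Integrable.fintype_prod (f := fun i (t:ℝ) => |t|^k i * exp (-|t|^p)) fun i => Jm_int hp (k i)
    · exact Filter.Eventually.of_forall fun x => Finset.prod_nonneg fun i _ => by positivity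
  · fun_prop
  · intro t ht x
    rw [← ENNReal.ofReal_mul (by positivity)]
    congr 1
    simp only [Pi.smul_apply, smul_eq_mul, abs_mul, mul_pow, abs_of_pos ht]
    rw [Finset.prod_mul_distrib, Finset.prod_pow_eq_pow_sum]

lemma lpBall_eq (n : ℕ) (p : ℝ) :
    lpBall n p = (WithLp.ofLp : E n → (Fin n → ℝ)) ⁻¹' {x | Np n p x ≤ 1} := rfl

lemma lpBall_compact {n : ℕ} {p : ℝ} (hp : 1 ≤ p) : IsCompact (lpBall n p) := by
  have hp0 : 0 < p := by linarith
  refine Metric.isCompact_of_isClosed_isBounded ?_ ?_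
  · rw [lpBall_eq]
    refine IsClosed.preimage (PiLp.continuous_ofLp 2 _) ?_
    exact isClosed_le (Np_cont hp0) continuous_const
  · rw [isBounded_iff_forall_norm_le]
    refine ⟨Real.sqrt n, fun x hx => ?_⟩
    rw [EuclideanSpace.norm_eq]
    refine Real.sqrt_le_sqrt ?_
    have hi : ∀ i ∈ Finset.univ, ‖x i‖^2 ≤ (1:ℝ) := by
      intro i _
      have h1 : |x i|^p ≤ 1 := (Finset.single_le_sum (f := fun i => |x i|^p)
        (fun j _ => by positivity) (Finset.mem_univ i)).trans hx
      have h2 : |x i| ≤ 1 := by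
        by_contra h
        push Not at h
        exact absurd (Real.one_lt_rpow h hp0) (not_lt.2 h1)
      rw [Real.norm_eq_abs]
      exact pow_le_one₀ (abs_nonneg _) h2
    simpa using Finset.sum_le_sum hi

lemma momentE {n : ℕ} {p : ℝ} (hp : 1 ≤ p) (k : Fin n → ℕ) :
    Gamma (((n:ℝ)+(∑ i, k i : ℕ))/p+1) * ∫ x in lpBall n p, ∏ i, |x i|^k i =
    ∏ i, Jm p (k i) := by
  have hp0 : 0 < p := by linarith
  have h := congrArg ENNReal.toReal (moment hp k)
  have hJ : 0 ≤ ∏ i, Jm p (k i) := Finset.prod_nonneg fun i _ =>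
    integral_nonneg fun t => by positivity
  have hG := Real.Gamma_pos_of_pos (s := ((n:ℝ)+(∑ i, k i : ℕ))/p+1) (by positivity)
  rw [ENNReal.toReal_mul, ENNReal.toReal_ofReal hG.le, ENNReal.toReal_ofReal hJ] at h
  rw [← h, integral_eq_lintegral_of_nonneg_ae]
  · congr 2
    have hB : MeasurableSet {x | Np n p x ≤ 1} := (Np_cont hp0).measurable measurableSet_Iic
    rw [lpBall_eq]
    exact (PiLp.volume_preserving_ofLp (Fin n)).setLIntegral_comp_preimage hB
      (f := fun x : Fin n → ℝ => ENNReal.ofReal (∏ i, |x i|^k i)) (by fun_prop)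
  · exact Filter.Eventually.of_forall fun x => Finset.prod_nonneg fun i _ => by positivity
  · exact Continuous.aestronglyMeasurable (by fun_prop)

/-- exponents `a` at `i`, `b` at `j`, zero elsewhere -/
def kk {n : ℕ} (i j : Fin n) (a b : ℕ) : Fin n → ℕ := fun l => if l = i then a else if l = j then b else 0

lemma prod_kk {n : ℕ} {i j : Fin n} (hij : i ≠ j) (a b : ℕ) (f : Fin n → ℕ → ℝ) :
    ∏ l, f l (kk i j a b l) = f i a * (f j b * ∏ l ∈ (Finset.univ.erase i).erase j, f l 0) := by
  rw [← Finset.mul_prod_erase _ _ (Finset.mem_univ i),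
    ← Finset.mul_prod_erase (Finset.univ.erase i) _ (a := j) (by simp [hij.symm])]
  have h : ∏ l ∈ (Finset.univ.erase i).erase j, f l (kk i j a b l) =
      ∏ l ∈ (Finset.univ.erase i).erase j, f l 0 := by
    refine Finset.prod_congr rfl fun l hl => ?_
    simp only [Finset.mem_erase] at hl
    simp [kk, hl.1, hl.2.1]
  rw [h]
  simp [kk, hij.symm]

lemma sum_kk {n : ℕ} {i j : Fin n} (hij : i ≠ j) (a b : ℕ) : ∑ l, kk i j a b l = a + b := by
  rw [← Finset.add_sum_erase _ _ (Finset.mem_univ i),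
    ← Finset.add_sum_erase (Finset.univ.erase i) _ (a := j) (by simp [hij.symm])]
  have h : ∑ l ∈ (Finset.univ.erase i).erase j, kk i j a b l = 0 := by
    refine Finset.sum_eq_zero fun l hl => ?_
    simp only [Finset.mem_erase] at hl
    simp [kk, hl.1, hl.2.1]
  rw [h]
  simp [kk, hij.symm]

lemma moment2 {n : ℕ} {p : ℝ} (hp : 1 ≤ p) {i j : Fin n} (hij : i ≠ j) (a b : ℕ) :
    Gamma (((n:ℝ)+((a + b : ℕ) : ℝ))/p+1) * ∫ x in lpBall n p, |x i|^a * |x j|^b =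
    Jm p a * Jm p b * Jm p 0 ^ (n-2) := by
  have h := momentE hp (kk i j a b)
  rw [sum_kk hij, prod_kk hij a b (fun _ m => Jm p m)] at h
  have e : ∀ x : E n, ∏ l, |x l|^(kk i j a b l) = |x i|^a * |x j|^b := by
    intro x
    rw [prod_kk hij a b (fun l m => |x l|^m)]
    simp
  simp_rw [e] at h
  rw [h, Finset.prod_const, Finset.card_erase_of_mem (by simp [hij.symm]),
    Finset.card_erase_of_mem (Finset.mem_univ _), Finset.card_univ, Fintype.card_fin, Nat.sub_sub]
  ring

lemma unif_int {n : ℕ} (K : Set (E n)) (f : E n → ℝ) :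
    ∫ x, f x ∂(unif K) = (volume.real K)⁻¹ * ∫ x in K, f x := by
  unfold unif
  rw [integral_smul_measure, smul_eq_mul, ENNReal.toReal_inv]
  rfl

lemma int_lin {n : ℕ} {K : Set (E n)} {f g h : E n → ℝ} (hf : IntegrableOn f K)
    (hg : IntegrableOn g K) (hh : IntegrableOn h K) (a b c : ℝ) :
    ∫ x in K, (a * f x + b * g x + c * h x) =
      a * (∫ x in K, f x) + b * (∫ x in K, g x) + c * (∫ x in K, h x) := by
  have h1 : Integrable (fun x => a * f x) (volume.restrict K) := hf.const_mul a
  have h2 : Integrable (fun x => b * g x) (volume.restrict K) := hg.const_mul b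
  have h3 : Integrable (fun x => c * h x) (volume.restrict K) := hh.const_mul c
  have h12 : Integrable (fun x => a * f x + b * g x) (volume.restrict K) := h1.add h2
  rw [integral_add h12 h3, integral_add h1 h2, integral_const_mul, integral_const_mul,
    integral_const_mul]

lemma core {n : ℕ} {p : ℝ} (hp : 1 ≤ p) {i j : Fin n} (hij : i ≠ j)
    (hG : Gamma (n/p+1) * Gamma (((n:ℝ)+4)/p+1) <
      ((Jm p 4 * Jm p 0 / Jm p 2 ^ 2 - 1)/2) * Gamma (((n:ℝ)+2)/p+1)^2)
    {u v : E n} (hu : ∀ x : E n, ⟪x, u⟫ = (x i + x j) / √2)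
    (hv : ∀ x : E n, ⟪x, v⟫ = (x i - x j) / √2) :
    (∫ x, ⟪x, u⟫ ^ 2 ∂(unif (lpBall n p))) * (∫ x, ⟪x, v⟫ ^ 2 ∂(unif (lpBall n p))) <
          ∫ x, ⟪x, u⟫ ^ 2 * ⟪x, v⟫ ^ 2 ∂(unif (lpBall n p)) := by
  have hp0 : 0 < p := by linarith
  have hK := lpBall_compact (n := n) hp
  simp_rw [unif_int, hu, hv]
  have s2 : √2 ^ 2 = (2:ℝ) := Real.sq_sqrt (by norm_num)
  have f1 : ∀ x : E n, ((x i + x j) / √2)^2 = 1/2 * (|x i|^2*|x j|^0) + 1/2 * (|x j|^2*|x i|^0) + x i * x j := by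
    intro x; rw [div_pow, s2, sq_abs, sq_abs]; ring
  have f2 : ∀ x : E n, ((x i - x j) / √2)^2 = 1/2 * (|x i|^2*|x j|^0) + 1/2 * (|x j|^2*|x i|^0) - x i * x j := by
    intro x; rw [div_pow, s2, sq_abs, sq_abs]; ring
  have f3 : ∀ x : E n, ((x i + x j) / √2)^2 * ((x i - x j) / √2)^2 =
      1/4 * (|x i|^4*|x j|^0) + 1/4 * (|x j|^4*|x i|^0) - 1/2 * (|x i|^2*|x j|^2) := by
    intro x
    have h4 : ∀ y : ℝ, |y|^4 = y^4 := fun y => by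
      rw [show 4 = 2*2 by norm_num, pow_mul, sq_abs, pow_mul]
    rw [div_pow, div_pow, s2, sq_abs, sq_abs, h4, h4]; ring
  have I : ∀ (l m : Fin n) (a b : ℕ), IntegrableOn (fun x : E n => |x l|^a * |x m|^b) (lpBall n p) := by
    intro l m a b
    exact ContinuousOn.integrableOn_compact hK (Continuous.continuousOn (by fun_prop))
  have Ic : IntegrableOn (fun x : E n => x i * x j) (lpBall n p) :=
    ContinuousOn.integrableOn_compact hK (Continuous.continuousOn (by fun_prop))
  have g1 : ∫ x in lpBall n p, ((x i + x j) / √2)^2 =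
      1/2 * (∫ x in lpBall n p, |x i|^2*|x j|^0) + 1/2 * (∫ x in lpBall n p, |x j|^2*|x i|^0)
        + ∫ x in lpBall n p, x i * x j := by
    have h := int_lin (I i j 2 0) (I j i 2 0) Ic (1/2) (1/2) 1
    refine (integral_congr_ae (Filter.Eventually.of_forall fun x => ?_)).trans (h.trans (by ring))
    exact (f1 x).trans (by ring)
  have g2 : ∫ x in lpBall n p, ((x i - x j) / √2)^2 =
      1/2 * (∫ x in lpBall n p, |x i|^2*|x j|^0) + 1/2 * (∫ x in lpBall n p, |x j|^2*|x i|^0)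
        - ∫ x in lpBall n p, x i * x j := by
    have h := int_lin (I i j 2 0) (I j i 2 0) Ic (1/2) (1/2) (-1)
    refine (integral_congr_ae (Filter.Eventually.of_forall fun x => ?_)).trans (h.trans (by ring))
    exact (f2 x).trans (by ring)
  have g3 : ∫ x in lpBall n p, ((x i + x j) / √2)^2 * ((x i - x j) / √2)^2 =
      1/4 * (∫ x in lpBall n p, |x i|^4*|x j|^0) + 1/4 * (∫ x in lpBall n p, |x j|^4*|x i|^0)
        - 1/2 * ∫ x in lpBall n p, |x i|^2*|x j|^2 := by
    have h := int_lin (I i j 4 0) (I j i 4 0) (I i j 2 2) (1/4) (1/4) (-1/2)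
    refine (integral_congr_ae (Filter.Eventually.of_forall fun x => ?_)).trans (h.trans (by ring))
    exact (f3 x).trans (by ring)
  rw [g1, g2, g3]
  have m0 := moment2 hp hij 0 0
  have m2 := moment2 hp hij 2 0
  have m2' := moment2 hp hij.symm 2 0
  have m4 := moment2 hp hij 4 0
  have m4' := moment2 hp hij.symm 4 0
  have m22 := moment2 hp hij 2 2
  have e0 : ∫ x in lpBall n p, |x i|^0 * |x j|^0 = volume.real (lpBall n p) := by simp
  rw [e0] at m0
  have JP : ∀ k, 0 < Jm p k := fun k => by
    rw [Jm_eq hp0]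
    have := Real.Gamma_pos_of_pos (s := ((k:ℝ)+1)/p) (by positivity)
    positivity
  have j0 := JP 0
  have j2 := JP 2
  have j4 := JP 4
  have G0p := Real.Gamma_pos_of_pos (s := (n:ℝ)/p+1) (by positivity)
  have G2p := Real.Gamma_pos_of_pos (s := ((n:ℝ)+2)/p+1) (by positivity)
  have G4p := Real.Gamma_pos_of_pos (s := ((n:ℝ)+4)/p+1) (by positivity)
  have c0 : (n:ℝ) + ((0+0:ℕ):ℝ) = n := by norm_num
  have c2 : (n:ℝ) + ((2+0:ℕ):ℝ) = n + 2 := by norm_num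
  have c4 : (n:ℝ) + ((4+0:ℕ):ℝ) = n + 4 := by norm_num
  have c22 : (n:ℝ) + ((2+2:ℕ):ℝ) = n + 4 := by norm_num
  rw [c0] at m0
  rw [c2] at m2 m2'
  rw [c4] at m4 m4'
  rw [c22] at m22
  have hP : 0 < Jm p 0 ^ (n-2) := by positivity
  revert m0 m2 m2' m4 m4' m22 hP
  generalize (∫ x in lpBall n p, |x i|^2*|x j|^0) = A
  generalize (∫ x in lpBall n p, |x j|^2*|x i|^0) = A'
  generalize (∫ x in lpBall n p, |x i|^4*|x j|^0) = M
  generalize (∫ x in lpBall n p, |x j|^4*|x i|^0) = M'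
  generalize (∫ x in lpBall n p, |x i|^2*|x j|^2) = Q
  generalize (∫ x in lpBall n p, x i * x j) = C
  generalize volume.real (lpBall n p) = V
  generalize Jm p 0 ^ (n-2) = P
  generalize Gamma (n/p+1) = G0 at *
  generalize Gamma (((n:ℝ)+2)/p+1) = G2 at *
  generalize Gamma (((n:ℝ)+4)/p+1) = G4 at *
  generalize Jm p 0 = J0 at *
  generalize Jm p 2 = J2 at *
  generalize Jm p 4 = J4 at *
  intro m0 m2 m2' m4 m4' m22 hP
  rw [mul_comm, ← eq_div_iff (by positivity)] at m0 m2 m2' m4 m4' m22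
  subst m0 m2 m2' m4 m4' m22
  set V := J0 * J0 * P / G0 with hV
  set A := J2 * J0 * P / G2 with hA
  set M := J4 * J0 * P / G4 with hM
  set Q := J2 * J2 * P / G4 with hQ
  have hVp : 0 < V := by positivity
  have key : 2 * A^2 < V * (M - Q) := by
    have h1 : (J4 * J0 / J2 ^ 2 - 1) / 2 * G2 ^ 2 = (J4*J0 - J2^2) * G2^2 / (2*J2^2) := by
      field_simp
    rw [h1, lt_div_iff₀ (by positivity)] at hG
    have h2 : V * (M-Q) - 2*A^2 =
        J0^2*P^2/(G0*G4*G2^2) * ((J4*J0 - J2^2) * G2^2 - G0*G4*(2*J2^2)) := by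
      rw [hV, hA, hM, hQ]; field_simp
    have h3 : 0 < J0^2*P^2/(G0*G4*G2^2) * ((J4*J0 - J2^2) * G2^2 - G0*G4*(2*J2^2)) :=
      mul_pos (by positivity) (by linarith)
    linarith
  have h5 : V⁻¹ * (1/4*M+1/4*M-1/2*Q) - V⁻¹ * (1/2*A+1/2*A+C) * (V⁻¹ * (1/2*A+1/2*A-C)) =
      (V⁻¹)^2 * ((V*(M-Q) - 2*A^2)/2 + C^2) := by
    field_simp; ring
  have h6 : 0 < (V⁻¹)^2 * ((V*(M-Q) - 2*A^2)/2 + C^2) := by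
    refine mul_pos (by positivity) ?_
    nlinarith [sq_nonneg C]
  linarith

lemma Jm_ineq {p : ℝ} (hp1 : 1 ≤ p) (hp2 : p < 2) : 1 < (Jm p 4 * Jm p 0 / Jm p 2 ^ 2 - 1)/2 := by
  have hp0 : 0 < p := by linarith
  have h := gamma_ineq (x := 1/p) (by rw [div_lt_div_iff₀ (by norm_num) hp0]; linarith)
  have g := Real.Gamma_pos_of_pos (s := 3*(1/p)) (by positivity)
  rw [Jm_eq hp0, Jm_eq hp0, Jm_eq hp0]
  have e4 : (((4:ℕ):ℝ)+1)/p = 5*(1/p) := by push_cast; ring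
  have e2 : (((2:ℕ):ℝ)+1)/p = 3*(1/p) := by push_cast; ring
  have e0 : (((0:ℕ):ℝ)+1)/p = 1/p := by push_cast; ring
  rw [e4, e2, e0]
  have : 3 < 2 * (1 / p * Gamma (5 * (1 / p))) * (2 * (1 / p * Gamma (1 / p))) /
      (2 * (1 / p * Gamma (3 * (1 / p)))) ^ 2 := by
    rw [lt_div_iff₀ (by positivity)]
    have hq : 0 < 4 * (1/p)^2 := by positivity
    nlinarith [mul_lt_mul_of_pos_left h hq]
  linarith

/-- For `1 ≤ p < 2` and `n` large enough, a random vector uniformly distributed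
on `B_p^n` fails the square negative correlation property with respect to some orthonormal
basis of `ℝⁿ`; in particular there are orthonormal `η₁, η₂` with
`E⟨X,η₁⟩²⟨X,η₂⟩² > E⟨X,η₁⟩² E⟨X,η₂⟩²`. -/
theorem sncp_Bpn_fails_p_lt_two
    (p : ℝ) (hp1 : 1 ≤ p) (hp2 : p < 2) :
    ∃ n₀ : ℕ, ∀ n : ℕ, n₀ + 2 ≤ n →
      (∃ b : OrthonormalBasis (Fin n) ℝ (E n), ∃ i j : Fin n, i ≠ j ∧
        (∫ x, ⟪x, b i⟫ ^ 2 ∂(unif (lpBall n p))) * (∫ x, ⟪x, b j⟫ ^ 2 ∂(unif (lpBall n p))) <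
          ∫ x, ⟪x, b i⟫ ^ 2 * ⟪x, b j⟫ ^ 2 ∂(unif (lpBall n p))) ∧
      (∃ η₁ η₂ : E n, ‖η₁‖ = 1 ∧ ‖η₂‖ = 1 ∧ ⟪η₁, η₂⟫ = 0 ∧
        (∫ x, ⟪x, η₁⟫ ^ 2 ∂(unif (lpBall n p))) * (∫ x, ⟪x, η₂⟫ ^ 2 ∂(unif (lpBall n p))) <
          ∫ x, ⟪x, η₁⟫ ^ 2 * ⟪x, η₂⟫ ^ 2 ∂(unif (lpBall n p))) := by
  
  have hp0 : 0 < p := by linarith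
  obtain ⟨n₀, hn₀⟩ := Filter.eventually_atTop.1 (gamma_eventually hp0 (Jm_ineq hp1 hp2))
  refine ⟨n₀, fun n hn => ?_⟩
  have hG := hn₀ n (by omega)
  let i : Fin n := ⟨0, by omega⟩
  let j : Fin n := ⟨1, by omega⟩
  have hij : i ≠ j := by simp [i, j, Fin.ext_iff]
  have s2 : √2 * √2 = (2:ℝ) := Real.mul_self_sqrt (by norm_num)
  have s0 : (0:ℝ) < √2 := by positivity
  let u : E n := (√2)⁻¹ • (EuclideanSpace.single i 1 + EuclideanSpace.single j 1)
  let v : E n := (√2)⁻¹ • (EuclideanSpace.single i 1 - EuclideanSpace.single j 1)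
  have hu : ∀ x : E n, ⟪x, u⟫ = (x i + x j) / √2 := by
    intro x
    simp only [u, inner_smul_right, inner_add_right, EuclideanSpace.inner_single_right]
    simp; ring
  have hv : ∀ x : E n, ⟪x, v⟫ = (x i - x j) / √2 := by
    intro x
    simp only [v, inner_smul_right, inner_sub_right, EuclideanSpace.inner_single_right]
    simp; ring
  have hui : u i = (√2)⁻¹ := by simp [u, hij]
  have huj : u j = (√2)⁻¹ := by simp [u, hij.symm]
  have hvi : v i = (√2)⁻¹ := by simp [v, hij]
  have hvj : v j = -(√2)⁻¹ := by simp [v, hij.symm]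
  have huu : ‖u‖ = 1 := by
    have : ‖u‖^2 = 1 := by
      rw [← real_inner_self_eq_norm_sq, hu, hui, huj]; field_simp; linarith
    nlinarith [norm_nonneg u]
  have hvv : ‖v‖ = 1 := by
    have : ‖v‖^2 = 1 := by
      rw [← real_inner_self_eq_norm_sq, hv, hvi, hvj]; field_simp; linarith
    nlinarith [norm_nonneg v]
  have huv : ⟪u, v⟫ = 0 := by rw [hv, hui, huj]; simp
  have main := core hp1 hij hG hu hv
  refine ⟨?_, u, v, huu, hvv, huv, main⟩
  have hO : Orthonormal ℝ (Set.domRestrict ({i, j} : Set (Fin n)) (fun l => if l = i then u else v)) := by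
    constructor
    · rintro ⟨l, hl⟩
      change ‖if l = i then u else v‖ = 1
      split_ifs
      · exact huu
      · exact hvv
    · rintro ⟨l, hl⟩ ⟨m, hm⟩ hlm
      change ⟪if l = i then u else v, if m = i then u else v⟫ = 0
      have hlm' : l ≠ m := fun h => hlm (Subtype.ext h)
      rcases hl with rfl | hl <;> rcases hm with rfl | hm
      · exact absurd rfl hlm'
      · rw [if_pos rfl, if_neg (fun h => hlm' h.symm)]; exact huv
      · rw [if_neg hlm', if_pos rfl, real_inner_comm]; exact huv
      · exact absurd (hl.trans hm.symm) hlm'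
  obtain ⟨b, hb⟩ := hO.exists_orthonormalBasis_extension_of_card_eq (by simp)
  refine ⟨b, i, j, hij, ?_⟩
  have hbi : b i = u := by rw [hb i (by simp)]; simp
  have hbj : b j = v := by rw [hb j (by simp)]; simp [hij.symm]
  rw [hbi, hbj]
  exact main
end
end
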